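/- Let i < j in Fin n. Every x ∈ A_f with 2·x = 0 and (τ_i + τ_j)·x = 0 is invariant under the transposition Equiv.swap i j. -/

import Mathlib

open MvPolynomial

noncomputable section

/-- The ideal defining the splitting algebra of `f = Xⁿ + a₁Xⁿ⁻¹ + ⋯ + aₙ`. -/
def splittingIdeal (A : Type*) [CommRing A] (n : ℕ) (a : Fin n → A) :
    Ideal (MvPolynomial (Fin n) A) :=
  Ideal.span (Set.range fun k : Fin n =>
    esymm (Fin n) A (k.1 + 1) - C ((-1 : A) ^ (k.1 + 1) * a k))

/-- The splitting algebra `A_f`. -/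
abbrev SplittingAlg (A : Type*) [CommRing A] (n : ℕ) (a : Fin n → A) : Type _ :=
  MvPolynomial (Fin n) A ⧸ splittingIdeal A n a

/-- The quotient map `π`. -/
def splittingMk (A : Type*) [CommRing A] (n : ℕ) (a : Fin n → A) :
    MvPolynomial (Fin n) A →ₐ[A] SplittingAlg A n a :=
  Ideal.Quotient.mkₐ A (splittingIdeal A n a)

/-- The universal roots `τᵢ`. -/
def tau (A : Type*) [CommRing A] (n : ℕ) (a : Fin n → A) (i : Fin n) :
    SplittingAlg A n a :=
  splittingMk A n a (X i)

theorem rename_mem_splittingIdeal (A : Type*) [CommRing A] (n : ℕ) (a : Fin n → A)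
    (σ : Equiv.Perm (Fin n)) {p : MvPolynomial (Fin n) A}
    (hp : p ∈ splittingIdeal A n a) :
    rename (σ : Fin n → Fin n) p ∈ splittingIdeal A n a := by
  have h : (splittingIdeal A n a).map ((rename (σ : Fin n → Fin n)).toRingHom :
      MvPolynomial (Fin n) A →+* MvPolynomial (Fin n) A) ≤ splittingIdeal A n a := by
    rw [splittingIdeal, Ideal.map_span]
    refine Ideal.span_le.2 ?_
    rintro _ ⟨_, ⟨k, rfl⟩, rfl⟩
    have hren : (rename (σ : Fin n → Fin n))
        (esymm (Fin n) A (k.1 + 1) - C ((-1 : A) ^ (k.1 + 1) * a k))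
        = esymm (Fin n) A (k.1 + 1) - C ((-1 : A) ^ (k.1 + 1) * a k) := by
      rw [map_sub, esymm_isSymmetric (Fin n) A (k.1 + 1) σ, rename_C]
    show (rename (σ : Fin n → Fin n))
        (esymm (Fin n) A (k.1 + 1) - C ((-1 : A) ^ (k.1 + 1) * a k)) ∈ _
    rw [hren]
    exact Ideal.subset_span ⟨k, rfl⟩
  exact h (Ideal.mem_map_of_mem _ hp)

/-- The action of a permutation `σ` on the splitting algebra, as an `A`-algebra map. -/
def permHom (A : Type*) [CommRing A] (n : ℕ) (a : Fin n → A) (σ : Equiv.Perm (Fin n)) :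
    SplittingAlg A n a →ₐ[A] SplittingAlg A n a :=
  Ideal.Quotient.liftₐ (splittingIdeal A n a)
    ((splittingMk A n a).comp (rename (σ : Fin n → Fin n)))
    (fun p hp => by
      have h := rename_mem_splittingIdeal A n a σ hp
      show Ideal.Quotient.mkₐ A (splittingIdeal A n a) _ = 0
      rw [Ideal.Quotient.mkₐ_eq_mk]
      exact (Ideal.Quotient.eq_zero_iff_mem).2 h)

/-- The trivial `G`-invariants of the splitting algebra. -/
def trivialInv (A : Type*) [CommRing A] (n : ℕ) (a : Fin n → A)
    (G : Subgroup (Equiv.Perm (Fin n))) : Set (SplittingAlg A n a) :=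
  splittingMk A n a '' {p | ∀ σ ∈ G, rename (σ : Fin n → Fin n) p = p}

/-- The element `D_f = ∏_{i<j} (τᵢ + τⱼ)`. -/
def Df (A : Type*) [CommRing A] (n : ℕ) (a : Fin n → A) : SplittingAlg A n a :=
  ∏ p ∈ Finset.univ.filter (fun p : Fin n × Fin n => p.1 < p.2),
    (tau A n a p.1 + tau A n a p.2)

end

theorem X_sub_X_dvd_sub_rename_swap {R ι : Type*} [CommRing R] [DecidableEq ι] (i j : ι)
    (p : MvPolynomial ι R) :
    (X i - X j : MvPolynomial ι R) ∣ p - rename (Equiv.swap i j) p := by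
  set I : Ideal (MvPolynomial ι R) := Ideal.span {X i - X j}
  have hX : Ideal.Quotient.mk I (X i) = Ideal.Quotient.mk I (X j) :=
    Ideal.Quotient.eq.2 (Ideal.mem_span_singleton_self _)
  have h : Ideal.Quotient.mkₐ R I = (Ideal.Quotient.mkₐ R I).comp (rename (Equiv.swap i j)) := by
    refine algHom_ext fun k => ?_
    simp only [AlgHom.comp_apply, rename_X, Ideal.Quotient.mkₐ_eq_mk]
    rw [Equiv.swap_apply_def]
    split_ifs with hi hj
    · rw [hi, hX]
    · rw [hj, hX]
    · rfl
  exact Ideal.mem_span_singleton.1 (Ideal.Quotient.eq.1 (DFunLike.congr_fun h p))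

theorem X_sub_X_mul_eq_zero {R ι : Type*} [CommRing R] [DecidableEq ι] {i j : ι}
    (hij : i ≠ j) {p : MvPolynomial ι R} (hp : (X i - X j) * p = 0) : p = 0 := by
  let φ : MvPolynomial ι R →ₐ[R] MvPolynomial ι R :=
    aeval fun k => if k = i then X i + X j else X k
  let ψ : MvPolynomial ι R →ₐ[R] MvPolynomial ι R :=
    aeval fun k => if k = i then X i - X j else X k
  have hψφ : ψ.comp φ = AlgHom.id R _ := by
    refine algHom_ext fun k => ?_
    by_cases hk : k = i <;> simp [φ, ψ, hk, hij.symm]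
  have h : X i * φ p = 0 := by
    simpa [φ, hij.symm] using congrArg φ hp
  have hφ : φ p = 0 := by
    ext m
    rw [← coeff_X_mul m i, h, coeff_zero, coeff_zero]
  simpa [hφ] using (DFunLike.congr_fun hψφ p).symm

theorem exists_mem_span_sub_rename_swap_eq {R ι : Type*} [CommRing R] [DecidableEq ι]
    {s : Set (MvPolynomial ι R)} (i j : ι)
    (hs : ∀ g ∈ s, rename (Equiv.swap i j) g = g)
    {q : MvPolynomial ι R} (hq : q ∈ Ideal.span s) :
    ∃ r ∈ Ideal.span s, q - rename (Equiv.swap i j) q = (X i - X j) * r := by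
  induction hq using Submodule.closure_induction with
  | zero => exact ⟨0, zero_mem _, by simp⟩
  | add x y _ _ hx hy =>
    obtain ⟨r, hr, hxr⟩ := hx
    obtain ⟨t, ht, hyt⟩ := hy
    exact ⟨r + t, add_mem hr ht, by rw [map_add, mul_add, ← hxr, ← hyt]; ring⟩
  | smul_mem c g hg =>
    obtain ⟨d, hd⟩ := X_sub_X_dvd_sub_rename_swap i j c
    refine ⟨d * g, Ideal.mul_mem_left _ _ (Ideal.subset_span hg), ?_⟩
    rw [smul_eq_mul, map_mul, hs g hg, ← sub_mul, hd, mul_assoc]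

theorem rename_esymm_sub_C {R : Type*} [CommRing R] {ι : Type*} [Fintype ι]
    (σ : Equiv.Perm ι) (k : ℕ) (c : R) :
    rename σ (esymm ι R k - C c) = esymm ι R k - C c := by
  rw [map_sub, esymm_isSymmetric ι R k σ, rename_C]

/-- For `i < j` in `Fin n`, every `x ∈ A_f` with `2·x = 0` and
`(τ_i + τ_j)·x = 0` is invariant under `Equiv.swap i j`. -/
theorem ann_invariant_under_swap (A : Type*) [CommRing A] (n : ℕ) (hn : 1 ≤ n)
    (a : Fin n → A) (i j : Fin n) (hij : i < j) (x : SplittingAlg A n a)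
    (h2 : 2 * x = 0) (hsum : (tau A n a i + tau A n a j) * x = 0) :
    permHom A n a (Equiv.swap i j) x = x := by
  obtain ⟨p, rfl⟩ := Ideal.Quotient.mk_surjective x
  have hdiff {q : MvPolynomial (Fin n) A} (hq : q ∈ splittingIdeal A n a) :
      ∃ r ∈ splittingIdeal A n a,
        q - rename (Equiv.swap i j) q = (X i - X j) * r := by
    refine exists_mem_span_sub_rename_swap_eq i j ?_ hq
    rintro _ ⟨k, rfl⟩
    exact rename_esymm_sub_C _ _ _
  obtain ⟨d, hd⟩ := X_sub_X_dvd_sub_rename_swap i j p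
  have hmul {c : MvPolynomial (Fin n) A} (hc : rename (Equiv.swap i j) c = c)
      (hcp : c * p ∈ splittingIdeal A n a) : c * d ∈ splittingIdeal A n a := by
    obtain ⟨r, hr, hcr⟩ := hdiff hcp
    have hcd : c * d - r = 0 := by
      refine X_sub_X_mul_eq_zero hij.ne ?_
      rw [map_mul, hc] at hcr
      linear_combination hcr - c * hd
    rwa [sub_eq_zero.1 hcd]
  have h2d : 2 * d ∈ splittingIdeal A n a :=
    hmul (map_ofNat _ 2) (Ideal.Quotient.eq_zero_iff_mem.1 h2)
  have hsd : (X i + X j) * d ∈ splittingIdeal A n a :=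
    hmul (by simp [add_comm]) (Ideal.Quotient.eq_zero_iff_mem.1 hsum)
  change Ideal.Quotient.mk _ (rename (Equiv.swap i j) p) = _
  refine (Ideal.Quotient.eq.2 ?_).symm
  rw [hd, show (X i - X j) * d = (X i + X j) * d - X j * (2 * d) by ring]
  exact sub_mem hsd (Ideal.mul_mem_left _ _ h2d)
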